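/- arXiv:math/0512599 — 2 statements merged into one kernel-verified Lean document; each statement's English description precedes it below -/
import Mathlib

section
/- Let (Ω, F, P) be a probability space equipped with a right-continuous filtration (F_t)_{t≥0}, let h > 0, and let (S_t)_{t≥0} be an adapted process with S_0 = 0 almost surely whose sample paths are nondecreasing and right-continuous, such that for all 0 ≤ s ≤ t the increment S_t − S_s is independent of F_s and satisfies E[exp(−λ(S_t − S_s))] = exp(−(t−s)·λ/(λh+1)) for every λ ≥ 0. Fix x > 0 and let T = inf{s ≥ 0 : s − S_s > x}. Then for every y > 0, P(T ≤ y) ≤ exp(−x²/(4yh)). -/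
open MeasureTheory ProbabilityTheory Filter
open scoped NNReal ENNReal

/-- The exponential martingale `exp (-l * S t + t * ψ)` of a nondecreasing process `S` whose
increments are independent of the past and have Laplace transform `exp (-(t - s) * ψ)` at `l`. -/
theorem martingale_exp_neg_mul_add_mul
    {Ω : Type*} {mΩ : MeasurableSpace Ω} {μ : Measure Ω} [IsProbabilityMeasure μ]
    {ℱ : Filtration ℝ≥0 mΩ} {S : ℝ≥0 → Ω → ℝ} (hadapt : Adapted ℱ S)
    (h0 : ∀ᵐ ω ∂μ, S 0 ω = 0) (hmono : ∀ ω, Monotone fun s => S s ω)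
    (hindep : ∀ s t : ℝ≥0, s ≤ t →
      Indep (MeasurableSpace.comap (fun ω => S t ω - S s ω) (borel ℝ)) (ℱ s) μ)
    {l ψ : ℝ} (hl : 0 ≤ l)
    (hlaplace : ∀ s t : ℝ≥0, s ≤ t →
      ∫ ω, Real.exp (-l * (S t ω - S s ω)) ∂μ = Real.exp (-((t : ℝ) - (s : ℝ)) * ψ)) :
    Martingale (fun t ω => Real.exp (-l * S t ω + t * ψ)) ℱ μ := by
  have hM (t : ℝ≥0) : Measurable[ℱ t] fun ω => Real.exp (-l * S t ω + t * ψ) :=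
    Real.measurable_exp.comp (((hadapt t).const_mul _).add_const _)
  refine ⟨fun t => (hM t).stronglyMeasurable, fun s t hst => ?_⟩
  set D : Ω → ℝ := fun ω => S t ω - S s ω
  have hDm : Measurable D :=
    ((hadapt t).mono (ℱ.le t) le_rfl).sub ((hadapt s).mono (ℱ.le s) le_rfl)
  have hExpD : Integrable (fun ω => Real.exp (-l * D ω)) μ := by
    refine Integrable.of_bound (by fun_prop) 1 (ae_of_all _ fun ω => ?_)
    rw [Real.norm_eq_abs, Real.abs_exp, Real.exp_le_one_iff]
    have : 0 ≤ D ω := sub_nonneg.2 (hmono ω hst)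
    nlinarith
  have hbound : ∀ᵐ ω ∂μ, ‖Real.exp (-l * S s ω + s * ψ)‖ ≤ Real.exp (s * ψ) := by
    filter_upwards [h0] with ω hω
    rw [Real.norm_eq_abs, Real.abs_exp, Real.exp_le_exp]
    have : 0 ≤ S s ω := hω ▸ hmono ω (zero_le : 0 ≤ s)
    nlinarith
  have hexp : (fun ω => Real.exp (-l * S t ω + t * ψ)) =
      Real.exp (((t : ℝ) - s) * ψ) •
        ((fun ω => Real.exp (-l * S s ω + s * ψ)) * fun ω => Real.exp (-l * D ω)) := by
    ext ω
    simp only [Pi.smul_apply, Pi.mul_apply, smul_eq_mul, ← Real.exp_add, D]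
    ring_nf
  have hcond : μ[fun ω => Real.exp (-l * D ω) | ℱ s] =ᵐ[μ]
      fun _ => Real.exp (-((t : ℝ) - s) * ψ) := by
    rw [← hlaplace s t hst]
    refine condExp_indep_eq (m₁ := MeasurableSpace.comap D (borel ℝ)) ?_ (ℱ.le s) ?_
      (hindep s t hst)
    · rw [← BorelSpace.measurable_eq (α := ℝ)]
      exact hDm.comap_le
    · rw [← BorelSpace.measurable_eq (α := ℝ)]
      exact (Real.measurable_exp.comp ((comap_measurable D).const_mul _)).stronglyMeasurable
  beta_reduce
  rw [hexp]
  filter_upwards [condExp_smul (μ := μ) (Real.exp (((t : ℝ) - s) * ψ))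
      ((fun ω => Real.exp (-l * S s ω + s * ψ)) * fun ω => Real.exp (-l * D ω)) (ℱ s),
    condExp_stronglyMeasurable_mul_of_bound (ℱ.le s) (hM s).stronglyMeasurable hExpD _ hbound,
    hcond] with ω h₁ h₂ h₃
  rw [h₁, Pi.smul_apply, h₂, Pi.mul_apply, h₃, smul_eq_mul, ← Real.exp_add, ← Real.exp_add]
  ring_nf

/-- Doob's maximal inequality for a nonnegative discrete-time martingale. -/
theorem mul_measure_exists_le_martingale_le
    {Ω : Type*} {mΩ : MeasurableSpace Ω} {μ : Measure Ω} [IsFiniteMeasure μ]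
    {𝒢 : Filtration ℕ mΩ} {M : ℕ → Ω → ℝ} (hM : Martingale M 𝒢 μ) (hnonneg : 0 ≤ M)
    (c : ℝ≥0) (n : ℕ) :
    c * μ {ω | ∃ k ≤ n, c ≤ M k ω} ≤ ENNReal.ofReal (∫ ω, M 0 ω ∂μ) := by
  have hset : {ω | ∃ k ≤ n, c ≤ M k ω} =
      {ω | (c : ℝ) ≤ (Finset.range (n + 1)).sup' Finset.nonempty_range_add_one
        fun k => M k ω} := by
    ext ω
    simp [Finset.le_sup'_iff]
  have hint : ∫ ω, M 0 ω ∂μ = ∫ ω, M n ω ∂μ := by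
    simpa using hM.setIntegral_eq (Nat.zero_le n) MeasurableSet.univ
  rw [hset, hint]
  exact (maximal_ineq hM.submartingale hnonneg n).trans (ENNReal.ofReal_le_ofReal
    (setIntegral_le_integral (hM.integrable n) (ae_of_all _ (hnonneg n))))

/-- Doob's maximal inequality for a nonnegative martingale with right-continuous paths. -/
theorem mul_measure_exists_lt_martingale_le
    {Ω : Type*} {mΩ : MeasurableSpace Ω} {μ : Measure Ω} [IsFiniteMeasure μ]
    {ℱ : Filtration ℝ≥0 mΩ} {M : ℝ≥0 → Ω → ℝ} (hM : Martingale M ℱ μ) (hnonneg : 0 ≤ M)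
    (hrc : ∀ ω (s : ℝ≥0), ContinuousWithinAt (fun u => M u ω) (Set.Ici s) s)
    (c y : ℝ≥0) :
    c * μ {ω | ∃ s < y, c < M s ω} ≤ ENNReal.ofReal (∫ ω, M 0 ω ∂μ) := by
  let A : ℕ → Set Ω := fun n => {ω | ∃ k : ℕ, (k : ℝ≥0) / 2 ^ n ≤ y ∧ c ≤ M (k / 2 ^ n) ω}
  have hA : Monotone A := by
    refine monotone_nat_of_le_succ fun n ω => ?_
    rintro ⟨k, hk, hkM⟩
    have heq : ((2 * k : ℕ) : ℝ≥0) / 2 ^ (n + 1) = k / 2 ^ n := by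
      rw [pow_succ', Nat.cast_mul, Nat.cast_ofNat, mul_div_mul_left _ _ two_ne_zero]
    exact ⟨2 * k, heq ▸ hk, heq ▸ hkM⟩
  have hsub : {ω | ∃ s < y, c < M s ω} ⊆ ⋃ n, A n := by
    rintro ω ⟨s, hsy, hs⟩
    have hlim : Tendsto (fun n : ℕ => (⌈s * 2 ^ n⌉₊ : ℝ≥0) / 2 ^ n) atTop (nhds s) := by
      rw [← NNReal.tendsto_coe]
      have := (tendsto_nat_ceil_mul_div_atTop s.coe_nonneg).comp
        (tendsto_pow_atTop_atTop_of_one_lt (one_lt_two : (1 : ℝ) < 2))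
      refine this.congr fun n => ?_
      have hceil : ⌈(s : ℝ) * 2 ^ n⌉₊ = ⌈s * 2 ^ n⌉₊ :=
        eq_of_forall_ge_iff fun k => by
          rw [Nat.ceil_le, Nat.ceil_le, ← NNReal.coe_le_coe]
          push_cast
          rfl
      simp [hceil]
    have hlim' : Tendsto (fun n : ℕ => (⌈s * 2 ^ n⌉₊ : ℝ≥0) / 2 ^ n) atTop
        (nhdsWithin s (Set.Ici s)) :=
      tendsto_nhdsWithin_iff.2 ⟨hlim, Eventually.of_forall fun n =>
        Set.mem_Ici.2 ((le_div_iff₀ (by positivity)).2 (Nat.le_ceil _))⟩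
    obtain ⟨n, hn, hnM⟩ := ((hlim.eventually_lt_const hsy).and
      (((hrc ω s).tendsto.comp hlim').eventually_const_lt hs)).exists
    exact Set.mem_iUnion.2 ⟨n, _, hn.le, hnM.le⟩
  have hbound (n : ℕ) : c * μ (A n) ≤ ENNReal.ofReal (∫ ω, M 0 ω ∂μ) := by
    have hgrid : Monotone fun k : ℕ => (k : ℝ≥0) / 2 ^ n := fun i j hij => by
      dsimp only
      gcongr
    let 𝒢 : Filtration ℕ mΩ :=
      ⟨fun k => ℱ (k / 2 ^ n), fun i j hij => ℱ.mono (hgrid hij), fun _ => ℱ.le _⟩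
    have hN : Martingale (fun k : ℕ => M (k / 2 ^ n)) 𝒢 μ :=
      ⟨fun k => hM.1 _, fun i j hij => hM.2 _ _ (hgrid hij)⟩
    have := mul_measure_exists_le_martingale_le hN (fun k => hnonneg _) c ⌊y * 2 ^ n⌋₊
    simp only [Nat.cast_zero, zero_div] at this
    refine le_trans ?_ this
    gcongr
    rintro ω ⟨k, hk, hkM⟩
    exact ⟨k, Nat.le_floor ((div_le_iff₀ (by positivity)).1 hk), hkM⟩
  calc c * μ {ω | ∃ s < y, c < M s ω} ≤ c * μ (⋃ n, A n) := by gcongr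
    _ = ⨆ n, c * μ (A n) := by rw [hA.measure_iUnion, ENNReal.mul_iSup]
    _ ≤ _ := iSup_le hbound

/-- Lemma 3.1 of Eisenbaum–Kaspi: for a driftless subordinator `S` with Lévy exponent
`λ ↦ λ/(λh+1)`, the first time `T` that `s - S_s` exceeds `x` satisfies
`P(T ≤ y) ≤ exp(-x²/(4yh))`. -/
theorem subordinator_hitting_time_tail_bound
    {Ω : Type*} {mΩ : MeasurableSpace Ω} {μ : Measure Ω} [IsProbabilityMeasure μ]
    (ℱ : Filtration ℝ≥0 mΩ)
    (hright : ∀ t : ℝ≥0, ℱ t = ⨅ (s : ℝ≥0) (_ : t < s), ℱ s)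
    (h : ℝ) (hh : 0 < h)
    (S : ℝ≥0 → Ω → ℝ)
    (hadapt : Adapted ℱ S)
    (h0 : ∀ᵐ ω ∂μ, S 0 ω = 0)
    (hmono : ∀ ω, Monotone fun s => S s ω)
    (hrc : ∀ ω (s : ℝ≥0), ContinuousWithinAt (fun u => S u ω) (Set.Ici s) s)
    (hindep : ∀ s t : ℝ≥0, s ≤ t →
      Indep (MeasurableSpace.comap (fun ω => S t ω - S s ω) (borel ℝ)) (ℱ s) μ)
    (hlaplace : ∀ s t : ℝ≥0, s ≤ t → ∀ l : ℝ, 0 ≤ l →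
      ∫ ω, Real.exp (-l * (S t ω - S s ω)) ∂μ =
        Real.exp (-((t : ℝ) - (s : ℝ)) * (l / (l * h + 1))))
    (x : ℝ) (hx : 0 < x)
    (T : Ω → ℝ≥0∞)
    (hT : ∀ ω, T ω = sInf {t : ℝ≥0∞ | ∃ s : ℝ≥0, t = (s : ℝ≥0∞) ∧ (s : ℝ) - S s ω > x}) :
    ∀ y : ℝ, 0 < y →
      μ {ω | T ω ≤ ENNReal.ofReal y} ≤ ENNReal.ofReal (Real.exp (-(x ^ 2) / (4 * y * h))) := by
  have key (z : ℝ) (hz : 0 < z) : μ {ω | ∃ s : ℝ≥0, (s : ℝ) < z ∧ x < s - S s ω} ≤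
      ENNReal.ofReal (Real.exp (-(x ^ 2) / (4 * z * h))) := by
    set l : ℝ := x / (2 * z * h) with hl_def
    have hl : 0 < l := by positivity
    set ψ : ℝ := l / (l * h + 1)
    have hψ : l - ψ ≤ l ^ 2 * h := by
      have hpos : 0 < l * h + 1 := by positivity
      have : l - ψ = l ^ 2 * h / (l * h + 1) := by
        simp only [ψ]
        field_simp
        ring
      rw [this]
      exact div_le_self (by positivity) (by nlinarith [mul_pos hl hh])
    have hopt : x ^ 2 / (4 * z * h) = l * x - z * (l ^ 2 * h) := by
      rw [hl_def]
      field_simp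
      ring
    have hM := martingale_exp_neg_mul_add_mul hadapt h0 hmono hindep hl.le
      (fun s t hst => hlaplace s t hst l hl.le)
    have hmax := mul_measure_exists_lt_martingale_le hM
      (fun t ω => (Real.exp_pos _).le)
      (fun ω s => Real.continuous_exp.continuousAt.comp_continuousWithinAt
        (((hrc ω s).const_mul (-l)).add
          (by fun_prop : Continuous fun u : ℝ≥0 => (u : ℝ) * ψ).continuousWithinAt))
      (Real.exp (x ^ 2 / (4 * z * h))).toNNReal z.toNNReal
    have hone : ∫ ω, Real.exp (-l * S 0 ω + ((0 : ℝ≥0) : ℝ) * ψ) ∂μ = 1 := by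
      rw [integral_congr_ae (g := fun _ => 1)]
      · simp
      · filter_upwards [h0] with ω hω
        simp [hω]
    rw [hone, ENNReal.ofReal_one] at hmax
    have hsub : {ω | ∃ s : ℝ≥0, (s : ℝ) < z ∧ x < s - S s ω} ⊆
        {ω | ∃ s < z.toNNReal, ((Real.exp (x ^ 2 / (4 * z * h))).toNNReal : ℝ) <
          Real.exp (-l * S s ω + s * ψ)} := by
      rintro ω ⟨s, hsz, hs⟩
      refine ⟨s, Real.lt_toNNReal_iff_coe_lt.2 hsz, ?_⟩
      rw [Real.coe_toNNReal _ (Real.exp_pos _).le, Real.exp_lt_exp, hopt]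
      have h₁ : l * x < l * (s - S s ω) := mul_lt_mul_of_pos_left hs hl
      have h₂ : (s : ℝ) * (l - ψ) ≤ z * (l ^ 2 * h) :=
        (mul_le_mul_of_nonneg_left hψ s.coe_nonneg).trans (by gcongr)
      linarith
    refine (measure_mono hsub).trans ?_
    rw [neg_div, Real.exp_neg, ENNReal.ofReal_inv_of_pos (Real.exp_pos _), ENNReal.le_inv_iff_mul_le,
      mul_comm]
    exact hmax
  intro y hy
  have hlim : Tendsto (fun z : ℝ => ENNReal.ofReal (Real.exp (-(x ^ 2) / (4 * z * h))))
      (nhdsWithin y (Set.Ioi y)) (nhds (ENNReal.ofReal (Real.exp (-(x ^ 2) / (4 * y * h))))) := by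
    have hne : 4 * y * h ≠ 0 := by positivity
    have : ContinuousAt (fun z : ℝ => Real.exp (-(x ^ 2) / (4 * z * h))) y := by
      fun_prop (disch := assumption)
    exact (ENNReal.tendsto_ofReal this.tendsto).mono_left nhdsWithin_le_nhds
  refine ge_of_tendsto hlim ?_
  filter_upwards [self_mem_nhdsWithin] with z (hz : y < z)
  refine (measure_mono fun ω (hω : T ω ≤ _) => ?_).trans (key z (hy.trans hz))
  have hlt : T ω < ENNReal.ofReal z :=
    hω.trans_lt ((ENNReal.ofReal_lt_ofReal_iff (hy.trans hz)).2 hz)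
  rw [hT, sInf_lt_iff] at hlt
  obtain ⟨_, ⟨s, rfl, hs⟩, hsz⟩ := hlt
  exact ⟨s, Real.lt_toNNReal_iff_coe_lt.1 (ENNReal.coe_lt_coe.1 hsz), hs⟩
end

section
/- Let m : (0,∞) → (0,∞) be a nondecreasing function with m(ε) → 0 as ε → 0+, and define its generalized inverse h̄(x) = inf{y > 0 : m(y) > x} for x > 0. Then the following are equivalent: (i) ∫₀^{ε₀} √(ln(1/m(ε))) dε < ∞ for some ε₀ > 0; (ii) ∫₀^{x₀} h̄(x) / (x √(ln(1/x))) dx < ∞ for some x₀ ∈ (0,1). -/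
open MeasureTheory Filter
open scoped ENNReal

lemma lintegral_Icc_one_div_mul_sqrt_log {a b : ℝ} (ha : 0 < a) (hab : a ≤ b) (hb : b < 1) :
    ∫⁻ x in Set.Icc a b, ENNReal.ofReal (1 / (x * Real.sqrt (Real.log (1 / x)))) =
      ENNReal.ofReal
        (2 * Real.sqrt (Real.log (1 / a)) - 2 * Real.sqrt (Real.log (1 / b))) := by
  have hlog : ∀ x ∈ Set.Icc a b, 0 < Real.log (1 / x) := fun x hx =>
    Real.log_pos (one_lt_one_div (ha.trans_le hx.1) (hx.2.trans_lt hb))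
  have hcont : ContinuousOn (fun x => 1 / (x * Real.sqrt (Real.log (1 / x)))) (Set.Icc a b) := by
    have h0 : ∀ x ∈ Set.Icc a b, x ≠ 0 := fun x hx => (ha.trans_le hx.1).ne'
    have h1 : ContinuousOn (fun x : ℝ => 1 / x) (Set.Icc a b) :=
      continuousOn_const.div continuousOn_id h0
    refine continuousOn_const.div (continuousOn_id.mul
      (h1.log fun x hx => one_div_ne_zero (h0 x hx)).sqrt) fun x hx => ?_
    exact mul_ne_zero (h0 x hx) (Real.sqrt_pos.2 (hlog x hx)).ne'
  have hderiv : ∀ x ∈ Set.uIcc a b,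
      HasDerivAt (fun x => -2 * Real.sqrt (Real.log (1 / x)))
        (1 / (x * Real.sqrt (Real.log (1 / x)))) x := by
    intro x hx
    rw [Set.uIcc_of_le hab] at hx
    have hx0 : x ≠ 0 := (ha.trans_le hx.1).ne'
    have hl := hlog x hx
    have hs := (Real.sqrt_pos.2 hl).ne'
    have h1 : HasDerivAt (fun x : ℝ => Real.log (1 / x)) (-x⁻¹) x := by
      simp only [one_div, Real.log_inv]
      exact (Real.hasDerivAt_log hx0).neg
    refine ((h1.sqrt hl.ne').const_mul (-2)).congr_deriv ?_
    field_simp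
  have hint := intervalIntegral.integral_eq_sub_of_hasDerivAt hderiv
    ((Set.uIcc_of_le hab ▸ hcont).intervalIntegrable)
  rw [intervalIntegral.integral_of_le hab, ← integral_Icc_eq_integral_Ioc] at hint
  rw [← ofReal_integral_eq_lintegral_ofReal hcont.integrableOn_Icc, hint]
  · congr 1
    ring
  · filter_upwards [ae_restrict_mem measurableSet_Icc] with x hx
    have hx0 := ha.trans_le hx.1
    simp only [Pi.zero_apply]
    positivity

lemma MonotoneOn.volume_sublevel_eq_ofReal_sInf {m : ℝ → ℝ}
    (hm : MonotoneOn m (Set.Ioi (0 : ℝ))) {x : ℝ} (hne : ∃ y, 0 < y ∧ x < m y) :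
    volume {y : ℝ | 0 < y ∧ m y ≤ x} = ENNReal.ofReal (sInf {y : ℝ | 0 < y ∧ x < m y}) := by
  set s := sInf {y : ℝ | 0 < y ∧ x < m y} with hs
  have hbdd : BddBelow {y : ℝ | 0 < y ∧ x < m y} := ⟨0, fun y hy => hy.1.le⟩
  apply le_antisymm
  · calc volume {y : ℝ | 0 < y ∧ m y ≤ x} ≤ volume (Set.Ioc 0 s) := by
          refine measure_mono fun y hy => ⟨hy.1, le_csInf hne fun z hz => ?_⟩
          by_contra! hzy
          exact (hz.2.trans_le ((hm hz.1 hy.1 hzy.le).trans hy.2)).false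
      _ = ENNReal.ofReal s := by rw [Real.volume_Ioc, sub_zero]
  · calc ENNReal.ofReal s = volume (Set.Ioo 0 s) := by rw [Real.volume_Ioo, sub_zero]
      _ ≤ volume {y : ℝ | 0 < y ∧ m y ≤ x} := by
          refine measure_mono fun y hy => ⟨hy.1, ?_⟩
          by_contra! hxy
          exact notMem_of_lt_csInf hy.2 hbdd ⟨hy.1, hxy⟩

/-- Tonelli's theorem for the region `{(x, y) | 0 < y, m y ≤ x ≤ x₀}`, with the weight
`1 / (x √(ln (1 / x)))` in the first variable. -/
lemma lintegral_generalizedInverse_eq {m : ℝ → ℝ}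
    (hm_pos : ∀ x ∈ Set.Ioi (0 : ℝ), 0 < m x)
    (hm_mono : MonotoneOn m (Set.Ioi (0 : ℝ))) {hbar : ℝ → ℝ}
    (hhbar : ∀ x : ℝ, 0 < x → hbar x = sInf {y : ℝ | 0 < y ∧ x < m y})
    {x₀ : ℝ} (hx₀ : x₀ < 1) (hne : ∃ y, 0 < y ∧ x₀ < m y) :
    ∫⁻ x in Set.Ioc (0 : ℝ) x₀,
        ENNReal.ofReal (hbar x / (x * Real.sqrt (Real.log (1 / x)))) =
      ∫⁻ y in {y : ℝ | 0 < y ∧ m y ≤ x₀}, ENNReal.ofReal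
        (2 * Real.sqrt (Real.log (1 / m y)) - 2 * Real.sqrt (Real.log (1 / x₀))) := by
  set M : ℝ → ℝ := (Set.Ioi (0 : ℝ)).indicator m with hM
  have hMpos : ∀ {y : ℝ}, 0 < y → M y = m y := fun hy => Set.indicator_of_mem hy m
  have hMmono : Monotone M := by
    intro y z hyz
    rcases le_or_gt y 0 with hy | hy
    · rw [hM, Set.indicator_of_notMem (by simpa using hy)]
      exact Set.indicator_nonneg (fun z hz => (hm_pos z hz).le) z
    · rw [hMpos hy, hMpos (hy.trans_le hyz)]
      exact hm_mono hy (hy.trans_le hyz) hyz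
  have hMmeas : Measurable M := hMmono.measurable
  set w : ℝ → ℝ≥0∞ := fun x => ENNReal.ofReal (1 / (x * Real.sqrt (Real.log (1 / x)))) with hw
  have hwmeas : Measurable w := by fun_prop
  have hregion : MeasurableSet {p : ℝ × ℝ | 0 < p.2 ∧ M p.2 ≤ p.1} :=
    (measurableSet_lt measurable_const measurable_snd).inter
      (measurableSet_le (hMmeas.comp measurable_snd) measurable_fst)
  have hsub : ∀ x, MeasurableSet {y : ℝ | 0 < y ∧ M y ≤ x} := fun x =>
    hregion.preimage (measurable_const.prodMk measurable_id : Measurable fun y => (x, y))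
  have hsub_eq : ∀ x, {y : ℝ | 0 < y ∧ M y ≤ x} = {y : ℝ | 0 < y ∧ m y ≤ x} := by
    intro x
    ext y
    exact and_congr_right fun hy => by rw [hMpos hy]
  let f : ℝ → ℝ → ℝ≥0∞ := fun x y =>
    {p : ℝ × ℝ | 0 < p.2 ∧ M p.2 ≤ p.1}.indicator (fun p => w p.1) (x, y)
  calc _ = ∫⁻ x in Set.Ioc (0 : ℝ) x₀, ∫⁻ y, f x y := by
        refine setLIntegral_congr_fun measurableSet_Ioc fun x hx => ?_
        obtain ⟨y, hy, hxy⟩ := hne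
        have hf : f x = {y : ℝ | 0 < y ∧ M y ≤ x}.indicator fun _ => w x := rfl
        simp only [hf]
        rw [lintegral_indicator_const (hsub x), hsub_eq,
          hm_mono.volume_sublevel_eq_ofReal_sInf ⟨y, hy, hx.2.trans_lt hxy⟩,
          ← hhbar x hx.1, hw, ← ENNReal.ofReal_mul (by have := hx.1; positivity)]
        congr 1
        ring
    _ = ∫⁻ y, ∫⁻ x in Set.Ioc (0 : ℝ) x₀, f x y :=
        lintegral_lintegral_swap
          ((hwmeas.comp measurable_fst).indicator hregion).aemeasurable
    _ = ∫⁻ y, {y : ℝ | 0 < y ∧ m y ≤ x₀}.indicator (fun y => ENNReal.ofReal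
        (2 * Real.sqrt (Real.log (1 / m y)) - 2 * Real.sqrt (Real.log (1 / x₀)))) y := by
        refine lintegral_congr fun y => ?_
        by_cases hy : 0 < y ∧ m y ≤ x₀
        · have hfy : (fun x => f x y) = (Set.Ici (m y)).indicator w := by
            funext x
            simp [f, Set.indicator, hy.1, hMpos hy.1]
          have hinter : Set.Ici (m y) ∩ Set.Ioc 0 x₀ = Set.Icc (m y) x₀ := by
            ext x
            have := hm_pos y hy.1
            simp only [Set.mem_inter_iff, Set.mem_Ici, Set.mem_Ioc, Set.mem_Icc]
            grind
          rw [Set.indicator_of_mem (by exact hy), hfy, lintegral_indicator measurableSet_Ici,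
            Measure.restrict_restrict measurableSet_Ici, hinter,
            lintegral_Icc_one_div_mul_sqrt_log (hm_pos y hy.1) hy.2 hx₀]
        · rw [Set.indicator_of_notMem (by exact hy),
            setLIntegral_congr_fun (g := 0) measurableSet_Ioc fun x hx => ?_]
          · simp
          · refine Set.indicator_of_notMem (fun h => hy ⟨h.1, ?_⟩) _
            rw [← hMpos h.1]
            exact h.2.trans hx.2
    _ = _ := lintegral_indicator (hsub_eq x₀ ▸ hsub x₀) _

/-- Equivalence of Barlow's conditions (2) and (3): for a nondecreasing `m : (0,∞) → (0,∞)`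
with `m(ε) → 0` as `ε → 0+` and generalized inverse `h̄(x) = inf{y > 0 : m(y) > x}`,
the condition `∫₀^{ε₀} √(ln(1/m(ε))) dε < ∞` (for some `ε₀ > 0`) is equivalent to
`∫₀^{x₀} h̄(x)/(x √(ln(1/x))) dx < ∞` (for some `x₀ ∈ (0,1)`). -/
theorem barlow_conditions_equivalent
    (m : ℝ → ℝ)
    (hm_pos : ∀ x ∈ Set.Ioi (0 : ℝ), 0 < m x)
    (hm_mono : MonotoneOn m (Set.Ioi (0 : ℝ)))
    (hm_lim : Tendsto m (nhdsWithin 0 (Set.Ioi 0)) (nhds 0))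
    (hbar : ℝ → ℝ)
    (hhbar : ∀ x : ℝ, 0 < x → hbar x = sInf {y : ℝ | 0 < y ∧ x < m y}) :
    (∃ ε₀ : ℝ, 0 < ε₀ ∧
        (∫⁻ ε in Set.Ioc (0 : ℝ) ε₀,
          ENNReal.ofReal (Real.sqrt (Real.log (1 / m ε)))) < ⊤) ↔
      (∃ x₀ ∈ Set.Ioo (0 : ℝ) 1,
        (∫⁻ x in Set.Ioc (0 : ℝ) x₀,
          ENNReal.ofReal (hbar x / (x * Real.sqrt (Real.log (1 / x))))) < ⊤) := by
  constructor
  · rintro ⟨ε₀, hε₀, hfin⟩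
    have hmε := hm_pos ε₀ hε₀
    obtain ⟨x₀, hx₀, hlt⟩ := exists_between (lt_min hmε one_pos)
    obtain ⟨hxm, hx1⟩ := lt_min_iff.1 hlt
    refine ⟨x₀, ⟨hx₀, hx1⟩, ?_⟩
    rw [lintegral_generalizedInverse_eq hm_pos hm_mono hhbar hx1 ⟨ε₀, hε₀, hxm⟩]
    have hsub : {y : ℝ | 0 < y ∧ m y ≤ x₀} ⊆ Set.Ioc 0 ε₀ := by
      refine fun y hy => ⟨hy.1, ?_⟩
      by_contra! h
      exact (hxm.trans_le ((hm_mono hε₀ hy.1 h.le).trans hy.2)).false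
    calc _ ≤ ∫⁻ y in {y : ℝ | 0 < y ∧ m y ≤ x₀},
          2 * ENNReal.ofReal (Real.sqrt (Real.log (1 / m y))) := by
          refine lintegral_mono fun y => ?_
          rw [← ENNReal.ofReal_ofNat 2, ← ENNReal.ofReal_mul zero_le_two]
          exact ENNReal.ofReal_le_ofReal (sub_le_self _ (by positivity))
      _ ≤ ∫⁻ y in Set.Ioc 0 ε₀, 2 * ENNReal.ofReal (Real.sqrt (Real.log (1 / m y))) :=
          lintegral_mono_set hsub
      _ = 2 * ∫⁻ y in Set.Ioc 0 ε₀, ENNReal.ofReal (Real.sqrt (Real.log (1 / m y))) :=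
          lintegral_const_mul' _ _ ENNReal.ofNat_ne_top
      _ < ⊤ := ENNReal.mul_lt_top ENNReal.ofNat_lt_top hfin
  · rintro ⟨x₀, ⟨hx₀, hx1⟩, hfin⟩
    obtain ⟨x₁, hx₁, hlt⟩ := exists_between (lt_min (hm_pos 1 (Set.mem_Ioi.2 one_pos)) hx₀)
    obtain ⟨hxm, hx10⟩ := lt_min_iff.1 hlt
    replace hfin := (lintegral_mono_set (Set.Ioc_subset_Ioc_right hx10.le)).trans_lt hfin
    rw [lintegral_generalizedInverse_eq hm_pos hm_mono hhbar (hx10.trans hx1)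
      ⟨1, one_pos, hxm⟩] at hfin
    obtain ⟨ε₀, hε₀, hsub⟩ :=
      (mem_nhdsGT_iff_exists_Ioc_subset).1 (hm_lim.eventually (gt_mem_nhds hx₁))
    refine ⟨ε₀, hε₀, ?_⟩
    have hsub' : Set.Ioc 0 ε₀ ⊆ {y : ℝ | 0 < y ∧ m y ≤ x₁} :=
      fun y hy => ⟨hy.1, (hsub hy).le⟩
    calc _ ≤ ∫⁻ y in Set.Ioc 0 ε₀, (ENNReal.ofReal
          (2 * Real.sqrt (Real.log (1 / m y)) - 2 * Real.sqrt (Real.log (1 / x₁))) +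
            ENNReal.ofReal (2 * Real.sqrt (Real.log (1 / x₁)))) := by
          refine lintegral_mono fun y => ?_
          refine le_trans (ENNReal.ofReal_le_ofReal ?_) ENNReal.ofReal_add_le
          have := Real.sqrt_nonneg (Real.log (1 / m y))
          linarith
      _ = (∫⁻ y in Set.Ioc 0 ε₀, ENNReal.ofReal
          (2 * Real.sqrt (Real.log (1 / m y)) - 2 * Real.sqrt (Real.log (1 / x₁)))) +
            ∫⁻ _ in Set.Ioc 0 ε₀, ENNReal.ofReal (2 * Real.sqrt (Real.log (1 / x₁))) :=
          lintegral_add_right _ measurable_const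
      _ < ⊤ := by
          refine ENNReal.add_lt_top.2 ⟨(lintegral_mono_set hsub').trans_lt hfin, ?_⟩
          rw [setLIntegral_const]
          exact ENNReal.mul_lt_top ENNReal.ofReal_lt_top measure_Ioc_lt_top
end
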